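/- arXiv:0907.3723 — 3 statements merged into one kernel-verified Lean document; each statement's English description precedes it below -/
import Mathlib

section
/- Let q ≡ 1 (mod 5), let ψ ∈ F_q^*, and let χ be a multiplicative character of F_q^* of order 5. Let A_ψ be the affine curve y^5 = x^2(1-x)^3(x-ψ^5)^2 over F_q and let #A_ψ(F_q) be the number of pairs (x,y) ∈ F_q × F_q satisfying its equation. Then, as complex numbers, #A_ψ(F_q) = q + (2/q)·(N_{(0,0,0,1,4),χ}(q) + N_{(0,0,0,2,3),χ}(q)). -/
/-- The group of multiplicative characters of a finite field with values in `ℂ` is finite. -/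
noncomputable instance {F : Type*} [Field F] [Fintype F] : Fintype (MulChar F ℂ) :=
  Fintype.ofFinite _

/-- The Gauss sum `G(φ, χ) = ∑_{x ∈ F*} φ(x) χ(x)`. -/
noncomputable def gaussSum' {F : Type*} [Field F] [Fintype F]
    (φ : AddChar F ℂ) (χ : MulChar F ℂ) : ℂ :=
  letI := Classical.decEq F
  ∑ x : Fˣ, φ (x : F) * χ (x : F)

/-- `z` is the number of indices `j` such that `χ^{s_j} η` is trivial. -/
noncomputable def zNum {F : Type*} [Field F] [Fintype F]
    (χ η : MulChar F ℂ) (s : Fin 5 → ℤ) : ℕ :=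
  letI := Classical.decEq (MulChar F ℂ)
  (Finset.univ.filter (fun j : Fin 5 => χ ^ s j * η = 1)).card

/-- `δ = 0` if `z ≥ 1` and `δ = 1` if `z = 0`. -/
noncomputable def deltaNum {F : Type*} [Field F] [Fintype F]
    (χ η : MulChar F ℂ) (s : Fin 5 → ℤ) : ℕ :=
  if 1 ≤ zNum χ η s then 0 else 1

/-- `N_{(s₁,…,s₅),χ}(q) = (1/(q-1)) ∑_η q^{5-z-δ} G(φ,η⁵) / (∏_j G(φ,χ^{s_j} η)) η(1/(5ψ)⁵)`. -/
noncomputable def Ntuple {F : Type*} [Field F] [Fintype F]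
    (φ : AddChar F ℂ) (χ : MulChar F ℂ) (ψ : F) (s : Fin 5 → ℤ) : ℂ :=
  (1 / ((Fintype.card F : ℂ) - 1)) *
    ∑ η : MulChar F ℂ,
      (Fintype.card F : ℂ) ^ ((5 : ℤ) - zNum χ η s - deltaNum χ η s) *
        gaussSum' φ (η ^ 5) / (∏ j : Fin 5, gaussSum' φ (χ ^ s j * η)) *
        η ((((5 : F) * ψ) ^ 5)⁻¹)

section FunctionField
open Polynomial

section MonicSums
variable {F : Type*} [Field F]

/-- Monic polynomials of degree `n` are parametrised by their `n` lower coefficients. -/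
noncomputable def monicEquiv (F : Type*) [Field F] (n : ℕ) :
    {p : F[X] // p.Monic ∧ p.natDegree = n} ≃ (Fin n → F) :=
  (monicEquivDegreeLT n).trans (degreeLTEquiv F n).toEquiv

theorem coeff_monicEquiv_symm (n : ℕ) (v : Fin n → F) (i : Fin n) :
    ((monicEquiv F n).symm v).1.coeff i = v i := by
  obtain ⟨p, rfl⟩ := (monicEquiv F n).surjective v
  rw [Equiv.symm_apply_apply]
  obtain ⟨p, hp, rfl⟩ := p
  simp [monicEquiv, degreeLTEquiv, monicEquivDegreeLT, eraseLead_coeff, i.2.ne]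

variable [Finite F]

theorem finite_monic_natDegree_eq (n : ℕ) : {p : F[X] | p.Monic ∧ p.natDegree = n}.Finite :=
  have : Finite {p : F[X] | p.Monic ∧ p.natDegree = n} := Finite.of_equiv _ (monicEquiv F n).symm
  Set.toFinite _

/-- The monic polynomials of degree `n`. -/
noncomputable def monicsOfDegree (F : Type*) [Field F] [Finite F] (n : ℕ) : Finset F[X] :=
  (finite_monic_natDegree_eq n).toFinset

@[simp] theorem mem_monicsOfDegree {n : ℕ} {f : F[X]} :
    f ∈ monicsOfDegree F n ↔ f.Monic ∧ f.natDegree = n := by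
  simp [monicsOfDegree]

theorem sum_monicsOfDegree [Fintype F] (n : ℕ) (g : F[X] → ℂ) :
    ∑ f ∈ monicsOfDegree F n, g f = ∑ v : Fin n → F, g ((monicEquiv F n).symm v).1 := by
  symm
  refine Finset.sum_bij (fun v _ => ((monicEquiv F n).symm v).1) (fun v _ => ?_) ?_ ?_ ?_
  · simpa using ((monicEquiv F n).symm v).2
  · intro v _ w _ h
    exact (monicEquiv F n).symm.injective (Subtype.ext h)
  · intro f hf
    exact ⟨monicEquiv F n ⟨f, by simpa using hf⟩, Finset.mem_univ _, by simp⟩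
  · simp

/-- The monic irreducible polynomials of degree at most `n`. -/
noncomputable def monicIrreducibles (F : Type*) [Field F] [Finite F] (n : ℕ) : Finset F[X] :=
  open Classical in
  ((Finset.range (n + 1)).biUnion (monicsOfDegree F)).filter Irreducible

@[simp] theorem mem_monicIrreducibles {n : ℕ} {f : F[X]} :
    f ∈ monicIrreducibles F n ↔ f.Monic ∧ Irreducible f ∧ f.natDegree ≤ n := by
  simp [monicIrreducibles]
  tauto

open Classical in
theorem natDegree_eq_sum_irreducible_pow_dvd {n : ℕ} {f : F[X]} (hf : f.Monic)
    (hn : f.natDegree = n) :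
    n = ∑ P ∈ monicIrreducibles F n, ∑ j ∈ Finset.Icc 1 n, if P ^ j ∣ f then P.natDegree else 0 := by
  have hf0 := hf.ne_zero
  set s := UniqueFactorizationMonoid.normalizedFactors f with hs
  have hprod : s.prod = f := by
    rw [hs, UniqueFactorizationMonoid.prod_normalizedFactors_eq hf0, hf.normalize_eq_self]
  have hmem : ∀ P ∈ s, P.Monic ∧ Irreducible P ∧ P ∣ f := fun P hP => by
    have hi := UniqueFactorizationMonoid.irreducible_of_normalized_factor P hP
    refine ⟨?_, hi, UniqueFactorizationMonoid.dvd_of_mem_normalizedFactors hP⟩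
    rw [← UniqueFactorizationMonoid.normalize_normalized_factor P hP]
    exact monic_normalize hi.ne_zero
  have hdeg : n = ∑ P ∈ s.toFinset, s.count P * P.natDegree := by
    conv_lhs => rw [← hn, ← hprod, natDegree_multiset_prod_of_monic _ fun P hP => (hmem P hP).1]
    rw [Finset.sum_multiset_map_count]
    simp
  conv_lhs => rw [hdeg]
  rw [Finset.sum_subset (s₂ := monicIrreducibles F n)]
  · refine Finset.sum_congr rfl fun P hP => ?_
    obtain ⟨hPm, hPi, -⟩ := mem_monicIrreducibles.1 hP
    have key : ∀ j : ℕ, P ^ j ∣ f ↔ j ≤ s.count P := fun j => by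
      rw [pow_dvd_iff_le_emultiplicity,
        UniqueFactorizationMonoid.le_emultiplicity_iff_replicate_le_normalizedFactors hPi hf0,
        hPm.normalize_eq_self, Multiset.le_count_iff_replicate_le]
    have hle : s.count P ≤ n := by
      have h := natDegree_le_of_dvd ((key _).2 le_rfl) hf0
      rw [hn, natDegree_pow] at h
      exact (Nat.le_mul_of_pos_right _ hPi.natDegree_pos).trans h
    simp_rw [key]
    rw [← Finset.sum_filter, Finset.sum_const, smul_eq_mul]
    congr 1
    have : (Finset.Icc 1 n).filter (· ≤ s.count P) = Finset.Icc 1 (s.count P) := by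
      ext; simp; omega
    rw [this, Nat.card_Icc, Nat.add_sub_cancel]
  · intro P hP
    obtain ⟨h1, h2, h3⟩ := hmem P (Multiset.mem_toFinset.1 hP)
    exact mem_monicIrreducibles.2 ⟨h1, h2, hn ▸ natDegree_le_of_dvd h3 hf0⟩
  · intro P _ hP
    rw [Multiset.mem_toFinset] at hP
    rw [Multiset.count_eq_zero_of_notMem hP, zero_mul]

variable (L : F[X] → ℂ)

/-- The sum of `L` over all monic polynomials of degree `n`. -/
noncomputable def monicSum (n : ℕ) : ℂ := ∑ f ∈ monicsOfDegree F n, L f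

variable {L}

open Classical in
theorem sum_monics_pow_dvd (hL : ∀ f g : F[X], f.Monic → g.Monic → L (f * g) = L f * L g)
    {P : F[X]} (hP : P.Monic) (hL1 : L 1 = 1) (n j : ℕ) :
    ∑ f ∈ monicsOfDegree F n, (if P ^ j ∣ f then L f else 0) =
      if j * P.natDegree ≤ n then L P ^ j * monicSum L (n - j * P.natDegree) else 0 := by
  have hpow : L (P ^ j) = L P ^ j := by
    induction j with
    | zero => simpa using hL1
    | succ j ih => rw [pow_succ, pow_succ, hL _ _ (hP.pow j) hP, ih]
  rw [← Finset.sum_filter]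
  split_ifs with h
  · rw [monicSum, Finset.mul_sum]
    symm
    refine Finset.sum_bij (fun g _ => P ^ j * g) ?_ ?_ ?_ ?_
    · intro g hg
      obtain ⟨hg, hd⟩ := mem_monicsOfDegree.1 hg
      simp only [Finset.mem_filter, mem_monicsOfDegree]
      refine ⟨⟨(hP.pow j).mul hg, ?_⟩, dvd_mul_right _ _⟩
      rw [(hP.pow j).natDegree_mul hg, hP.natDegree_pow, hd]
      omega
    · intro g _ g' _ h
      exact mul_left_cancel₀ (hP.pow j).ne_zero h
    · intro f hf
      simp only [Finset.mem_filter, mem_monicsOfDegree] at hf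
      obtain ⟨⟨hfm, hfd⟩, g, rfl⟩ := hf
      have hg : g.Monic := (hP.pow j).of_mul_monic_left hfm
      refine ⟨g, ?_, rfl⟩
      rw [(hP.pow j).natDegree_mul hg, hP.natDegree_pow] at hfd
      exact mem_monicsOfDegree.2 ⟨hg, by omega⟩
    · intro g hg
      rw [hL _ _ (hP.pow j) (mem_monicsOfDegree.1 hg).1, hpow]
  · refine Finset.sum_eq_zero fun f hf => ?_
    simp only [Finset.mem_filter, mem_monicsOfDegree] at hf
    have := natDegree_le_of_dvd hf.2 hf.1.1.ne_zero
    rw [hP.natDegree_pow, hf.1.2] at this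
    exact absurd this h

theorem natCast_mul_monicSum (hL : ∀ f g : F[X], f.Monic → g.Monic → L (f * g) = L f * L g)
    (hL1 : L 1 = 1) (n : ℕ) :
    n * monicSum L n = ∑ P ∈ monicIrreducibles F n, ∑ j ∈ Finset.Icc 1 n,
      if j * P.natDegree ≤ n then
        P.natDegree * L P ^ j * monicSum L (n - j * P.natDegree) else 0 := by
  classical
  have h : ∀ f ∈ monicsOfDegree F n, (n : ℂ) * L f = ∑ P ∈ monicIrreducibles F n,
      ∑ j ∈ Finset.Icc 1 n, (P.natDegree : ℂ) * if P ^ j ∣ f then L f else 0 := fun f hf => by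
    obtain ⟨hm, hd⟩ := mem_monicsOfDegree.1 hf
    conv_lhs => rw [natDegree_eq_sum_irreducible_pow_dvd hm hd]
    push_cast
    simp_rw [Finset.sum_mul]
    refine Finset.sum_congr rfl fun P _ => Finset.sum_congr rfl fun j _ => ?_
    split_ifs <;> simp
  rw [monicSum, Finset.mul_sum, Finset.sum_congr rfl h, Finset.sum_comm]
  refine Finset.sum_congr rfl fun P hP => ?_
  rw [Finset.sum_comm]
  refine Finset.sum_congr rfl fun j _ => ?_
  rw [← Finset.mul_sum, sum_monics_pow_dvd hL (mem_monicIrreducibles.1 hP).1 hL1]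
  split_ifs <;> ring

/-- The sum over a finite extension of the completely multiplicative function `L`, evaluated at
the characteristic polynomials. -/
noncomputable def extensionSum (L : F[X] → ℂ) (K : Type*) [Field K] [Fintype K] [Algebra F K] : ℂ :=
  ∑ x : K, L (minpoly F x) ^ (Module.finrank F K / (minpoly F x).natDegree)

theorem card_filter_minpoly_eq (K : Type*) [Field K] [Fintype K] [Algebra F K] {P : F[X]}
    (hP : P.Monic) (hPi : Irreducible P) (hd : P.natDegree ∣ Module.finrank F K)
    [DecidableEq F[X]] :
    (Finset.univ.filter fun x : K => minpoly F x = P).card = P.natDegree := by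
  classical
  have hs : (P.map (algebraMap F K)).Splits := by
    have h := hPi.natDegree_dvd_iff_dvd_X_pow_card_pow_sub_X.1 hd
    rw [← Module.natCard_eq_pow_finrank] at h
    refine Splits.of_dvd ?_ ?_ (map_dvd (algebraMap F K) h)
    · simpa using Polynomial.splits_X_pow_nat_card_sub_X (K := K)
    · simpa using FiniteField.X_pow_card_sub_X_ne_zero K (Finite.one_lt_card (α := K))
  rw [← card_rootSet_eq_natDegree (PerfectField.separable_of_irreducible hPi) hs,
    ← Set.toFinset_card]
  congr 1
  ext x
  simp only [Finset.mem_filter, Finset.mem_univ, true_and, Set.mem_toFinset, mem_rootSet]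
  constructor
  · rintro rfl
    exact ⟨hPi.ne_zero, minpoly.aeval F x⟩
  · rintro ⟨-, h⟩
    exact (minpoly.eq_of_irreducible_of_monic hPi h hP).symm

theorem extensionSum_eq (K : Type*) [Field K] [Fintype K] [Algebra F K] {n : ℕ}
    (hn : Module.finrank F K ≤ n) :
    extensionSum L K = ∑ P ∈ monicIrreducibles F n, ∑ j ∈ Finset.Icc 1 n,
      if j * P.natDegree = Module.finrank F K then (P.natDegree : ℂ) * L P ^ j else 0 := by
  classical
  have hk : 0 < Module.finrank F K := Module.finrank_pos
  rw [extensionSum, ← Finset.sum_fiberwise_of_maps_to (s := Finset.univ)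
    (t := monicIrreducibles F n) (g := fun x : K => minpoly F x)]
  · refine Finset.sum_congr rfl fun P hP => ?_
    obtain ⟨hPm, hPi, -⟩ := mem_monicIrreducibles.1 hP
    rw [Finset.sum_congr rfl (g := fun _ => L P ^ (Module.finrank F K / P.natDegree))
      (fun x hx => by rw [(Finset.mem_filter.1 hx).2])]
    rw [Finset.sum_const, nsmul_eq_mul]
    by_cases hd : P.natDegree ∣ Module.finrank F K
    · rw [card_filter_minpoly_eq K hPm hPi hd]
      obtain ⟨j, hj⟩ := hd
      have hj1 : 1 ≤ j := by
        rcases Nat.eq_zero_or_pos j with h | h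
        · simp [h] at hj; omega
        · exact h
      have hjn : j ≤ n := (Nat.le_mul_of_pos_left _ hPi.natDegree_pos).trans (hj ▸ hn)
      rw [Finset.sum_eq_single j]
      · rw [if_pos (by rw [hj, mul_comm]), hj, Nat.mul_div_cancel_left _ hPi.natDegree_pos]
      · intro i _ hi
        rw [if_neg]
        intro h
        rw [hj, mul_comm] at h
        exact hi (Nat.eq_of_mul_eq_mul_left hPi.natDegree_pos h)
      · intro h
        exact absurd (Finset.mem_Icc.2 ⟨hj1, hjn⟩) h
    · rw [Finset.sum_eq_zero (s := Finset.Icc 1 n), Finset.card_eq_zero.2, Nat.cast_zero, zero_mul]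
      · refine Finset.filter_eq_empty_iff.2 fun x _ hx => hd ?_
        rw [← hx]
        exact minpoly.degree_dvd (IsIntegral.of_finite F x)
      · intro j _
        exact if_neg fun h => hd ⟨j, by rw [← h, mul_comm]⟩
  · intro x _
    have hx := IsIntegral.of_finite F x
    exact mem_monicIrreducibles.2 ⟨minpoly.monic hx, minpoly.irreducible hx,
      (minpoly.natDegree_le x).trans hn⟩

/-- Newton-type recursion relating the coefficients of the `L`-function of `L` to its sums over
finite extensions. -/
theorem natCast_mul_monicSum_eq_sum_extensionSum
    (hL : ∀ f g : F[X], f.Monic → g.Monic → L (f * g) = L f * L g) (hL1 : L 1 = 1)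
    (K : ℕ → Type*) [∀ k, Field (K k)] [∀ k, Fintype (K k)] [∀ k, Algebra F (K k)]
    (n : ℕ) (hK : ∀ k ∈ Finset.Icc 1 n, Module.finrank F (K k) = k) :
    n * monicSum L n = ∑ k ∈ Finset.Icc 1 n, extensionSum L (K k) * monicSum L (n - k) := by
  rw [natCast_mul_monicSum hL hL1]
  have h := fun k (hk : k ∈ Finset.Icc 1 n) =>
    congrArg (· * monicSum L (n - k))
      (extensionSum_eq (L := L) (K k) ((hK k hk).trans_le (Finset.mem_Icc.1 hk).2))
  simp only [Finset.sum_mul] at h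
  rw [Finset.sum_congr rfl h]
  conv_rhs => rw [Finset.sum_comm]
  refine Finset.sum_congr rfl fun P hP => ?_
  obtain ⟨-, hPi, -⟩ := mem_monicIrreducibles.1 hP
  conv_rhs => rw [Finset.sum_comm]
  refine Finset.sum_congr rfl fun j hj => ?_
  have hj := Finset.mem_Icc.1 hj
  split_ifs with h
  · rw [Finset.sum_eq_single (j * P.natDegree)]
    · rw [hK, if_pos rfl]
      exact Finset.mem_Icc.2 ⟨Nat.mul_pos hj.1 hPi.natDegree_pos, h⟩
    · intro k hk hne
      rw [hK k hk, if_neg hne.symm, zero_mul]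
    · intro h'
      exact absurd (Finset.mem_Icc.2 ⟨Nat.mul_pos hj.1 hPi.natDegree_pos, h⟩) h'
  · symm
    refine Finset.sum_eq_zero fun k hk => ?_
    rw [hK k hk, if_neg, zero_mul]
    rintro rfl
    exact h (Finset.mem_Icc.1 hk).2

end MonicSums

section PowerSum
variable {R : Type*} [CommRing R]

/-- The fifth power sum of the roots of a monic polynomial, as a polynomial in its coefficients. -/
noncomputable def fifthPowerSum (f : R[X]) : R :=
  let r : ℕ → R := f.reverse.coeff
  5 * r 1 ^ 3 * r 2 - r 1 ^ 5 - 5 * r 1 * r 2 ^ 2 - 5 * r 1 ^ 2 * r 3 + 5 * r 2 * r 3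
    + 5 * r 1 * r 4 - 5 * r 5

theorem fifthPowerSum_mul [IsDomain R] {f g : R[X]} (hf : f.Monic) (hg : g.Monic) :
    fifthPowerSum (f * g) = fifthPowerSum f + fifthPowerSum g := by
  have hf0 : f.reverse.coeff 0 = 1 := by rw [coeff_zero_reverse, hf.leadingCoeff]
  have hg0 : g.reverse.coeff 0 = 1 := by rw [coeff_zero_reverse, hg.leadingCoeff]
  simp only [fifthPowerSum, reverse_mul_of_domain, coeff_mul, Finset.Nat.antidiagonal_succ,
    Finset.Nat.antidiagonal_zero, Finset.sum_cons, Finset.map_singleton,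
    Finset.sum_singleton, Finset.map_cons, Function.Embedding.prodMap, Function.Embedding.coeFn_mk,
    Prod.map, Function.Embedding.refl_apply, hf0, hg0]
  simp only [Nat.succ_eq_add_one, Nat.reduceAdd]
  ring

theorem fifthPowerSum_map {S : Type*} [CommRing S] [Nontrivial S] (φ : R →+* S) {f : R[X]}
    (hf : f.Monic) : fifthPowerSum (f.map φ) = φ (fifthPowerSum f) := by
  have h5 : φ 5 = 5 := map_ofNat φ 5
  simp [fifthPowerSum, coeff_reverse, hf.natDegree_map φ, h5]

theorem fifthPowerSum_X_sub_C [IsDomain R] (a : R) : fifthPowerSum (X - C a) = a ^ 5 := by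
  simp [fifthPowerSum, coeff_reverse, revAt, coeff_X, coeff_C, Odd.neg_pow (show Odd 5 by decide)]

theorem fifthPowerSum_one : fifthPowerSum (1 : R[X]) = 0 := by
  have h : (1 : R[X]).reverse = 1 := by rw [← C_1, reverse_C]
  simp [fifthPowerSum, -coeff_one_reverse, h, coeff_one]

theorem fifthPowerSum_prod_X_sub_C [IsDomain R] (s : Multiset R) :
    fifthPowerSum (s.map fun a => X - C a).prod = (s.map (· ^ 5)).sum := by
  induction s using Multiset.induction_on with
  | empty => simp [fifthPowerSum_one]
  | cons a s ih =>
    rw [Multiset.map_cons, Multiset.prod_cons,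
      fifthPowerSum_mul (monic_X_sub_C a) (monic_multiset_prod_of_monic _ _ fun b _ =>
        monic_X_sub_C b), ih, fifthPowerSum_X_sub_C]
    simp

end PowerSum

section FiniteExtension
variable {F : Type*} [Field F] {K : Type*} [Field K] [Fintype K] [Algebra F K]

theorem finrank_div_natDegree_minpoly (x : K) :
    Module.finrank F K / (minpoly F x).natDegree =
      Module.finrank (IntermediateField.adjoin F {x}) K := by
  have hx := IsIntegral.of_finite F x
  rw [← IntermediateField.adjoin.finrank hx, ← Module.finrank_mul_finrank F
    (IntermediateField.adjoin F {x}) K, Nat.mul_div_cancel_left _ Module.finrank_pos]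

theorem norm_eq_coeff_zero_minpoly_pow (x : K) :
    Algebra.norm F x = ((-1) ^ (minpoly F x).natDegree * (minpoly F x).coeff 0) ^
      (Module.finrank F K / (minpoly F x).natDegree) := by
  have hx := IsIntegral.of_finite F x
  rw [finrank_div_natDegree_minpoly, Algebra.norm_eq_norm_adjoin]
  have := Algebra.PowerBasis.norm_gen_eq_coeff_zero_minpoly
    (IntermediateField.adjoin.powerBasis hx)
  rw [IntermediateField.adjoin.powerBasis_gen, IntermediateField.minpoly_gen,
    IntermediateField.adjoin.powerBasis_dim] at this
  rw [this]

theorem trace_eq_nextCoeff_minpoly_nsmul (x : K) :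
    Algebra.trace F K x =
      (Module.finrank F K / (minpoly F x).natDegree) • -(minpoly F x).nextCoeff := by
  rw [finrank_div_natDegree_minpoly, trace_eq_finrank_mul_minpoly_nextCoeff, nsmul_eq_mul]

theorem trace_pow_five_eq_nsmul [Finite F] (x : K) :
    Algebra.trace F K (x ^ 5) =
      (Module.finrank F K / (minpoly F x).natDegree) • fifthPowerSum (minpoly F x) := by
  classical
  have hx := IsIntegral.of_finite F x
  let L := IntermediateField.adjoin F {x}
  let E := AlgebraicClosure F
  let pb := IntermediateField.adjoin.powerBasis hx
  have hgen : pb.gen = IntermediateField.AdjoinSimple.gen F x :=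
    IntermediateField.adjoin.powerBasis_gen hx
  have hmin : minpoly F pb.gen = minpoly F x := by rw [hgen, IntermediateField.minpoly_gen]
  have hxL : algebraMap L K (pb.gen ^ 5) = x ^ 5 := by
    rw [hgen, map_pow, IntermediateField.AdjoinSimple.algebraMap_gen]
  rw [finrank_div_natDegree_minpoly, ← Algebra.trace_trace (S := L), ← hxL,
    Algebra.trace_algebraMap, map_nsmul]
  congr 1
  apply (algebraMap F E).injective
  rw [trace_eq_sum_embeddings E, ← fifthPowerSum_map _ (minpoly.monic hx)]
  have hsplit : ((minpoly F x).map (algebraMap F E)).Splits := IsAlgClosed.splits _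
  rw [hsplit.eq_prod_roots_of_monic ((minpoly.monic hx).map _), fifthPowerSum_prod_X_sub_C]
  have hnodup : ((minpoly F pb.gen).aroots E).Nodup := by
    rw [hmin]
    exact nodup_roots ((separable_map _).mpr
      (PerfectField.separable_of_irreducible (minpoly.irreducible hx)))
  rw [Fintype.sum_equiv pb.liftEquiv' _ (fun r => (r : E) ^ 5) fun σ => by
    rw [PowerBasis.liftEquiv'_apply_coe, map_pow],
    Finset.sum_mem_multiset _ _ (fun r : E => r ^ 5) fun r => rfl,
    Finset.sum_eq_multiset_sum, Multiset.toFinset_val, Multiset.dedup_eq_self.mpr hnodup, hmin]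

end FiniteExtension

section FifthRoots
variable {K : Type*} [Field K] [Fintype K]

theorem sum_range_pow_eq_card_fifth_roots [DecidableEq K] (f : K →* ℂ)
    (h5 : ∀ a ≠ 0, f a ^ 5 = 1) (h1 : ∃ a ≠ 0, f a ≠ 1) {a : K} (ha : a ≠ 0) :
    ∑ i ∈ Finset.range 5, f a ^ i = (Finset.univ.filter fun y : K => y ^ 5 = a).card := by
  obtain ⟨b, hb, hfb⟩ := h1
  obtain ⟨g, hg⟩ := IsCyclic.exists_generator (α := Kˣ)
  have hgprim (x : K) (hx : x ≠ 0) : ∃ n : ℕ, x = (g : K) ^ n := by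
    obtain ⟨n, hn⟩ := Submonoid.mem_powers_iff _ _ |>.mp
      (mem_powers_iff_mem_zpowers.mpr (hg (Units.mk0 x hx)))
    exact ⟨n, by rw [← Units.val_pow_eq_pow_val, hn, Units.val_mk0]⟩
  have hfg : f g ≠ 1 := by
    obtain ⟨n, rfl⟩ := hgprim b hb
    rintro h
    simp [h] at hfb
  have hprim : IsPrimitiveRoot (f g) 5 := by
    have := Fact.mk Nat.prime_five
    have : orderOf (f (g : K)) = 5 := orderOf_eq_prime (h5 _ g.ne_zero) hfg
    exact this ▸ IsPrimitiveRoot.orderOf _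
  have hdvd : 5 ∣ orderOf g := by
    apply (hprim.dvd_of_pow_eq_one _)
    rw [← map_pow, ← Units.val_pow_eq_pow_val, pow_orderOf_eq_one]
    simp
  obtain ⟨m, hm⟩ := hdvd
  have hζ : IsPrimitiveRoot ((g : K) ^ m) 5 :=
    (IsPrimitiveRoot.coe_units_iff.mpr (IsPrimitiveRoot.orderOf g)).pow (orderOf_pos g)
      (by rw [hm, mul_comm])
  have hcard : (Finset.univ.filter fun y : K => y ^ 5 = a).card =
      Multiset.card (nthRoots 5 a) := by
    rw [← Multiset.toFinset_card_of_nodup (hζ.nthRoots_nodup ha)]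
    congr 1
    ext y
    simp
  rw [hcard, hζ.card_nthRoots]
  split_ifs with h
  · obtain ⟨α, rfl⟩ := h
    have hα : α ≠ 0 := by
      rintro rfl
      simp at ha
    simp [h5 α hα]
  · obtain ⟨n, rfl⟩ := hgprim a ha
    rw [map_pow, Nat.cast_zero]
    have hn : Nat.Coprime n 5 := by
      rw [Nat.coprime_comm, Nat.Prime.coprime_iff_not_dvd (by norm_num)]
      rintro ⟨k, rfl⟩
      exact h ⟨(g : K) ^ k, by rw [← pow_mul, mul_comm]⟩
    exact (hprim.pow_of_coprime n hn).geom_sum_eq_zero (by norm_num)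

end FifthRoots

section TwistedSums
variable {F : Type*} [Field F]

/-- The function `f ↦ η ((-1) ^ deg f * f(0)) * φ (t f)` on polynomials. -/
noncomputable def twistedValue (φ : AddChar F ℂ) (η : MulChar F ℂ) (t : F[X] → F) (f : F[X]) : ℂ :=
  η ((-1) ^ f.natDegree * f.coeff 0) * φ (t f)

theorem twistedValue_mul (φ : AddChar F ℂ) (η : MulChar F ℂ) {t : F[X] → F} {f g : F[X]}
    (hf : f.Monic) (hg : g.Monic) (ht : t (f * g) = t f + t g) :
    twistedValue φ η t (f * g) = twistedValue φ η t f * twistedValue φ η t g := by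
  rw [twistedValue, hf.natDegree_mul hg, mul_coeff_zero, ht, AddChar.map_add_eq_mul, pow_add,
    mul_mul_mul_comm, map_mul, twistedValue, twistedValue]
  ring

theorem twistedValue_one (φ : AddChar F ℂ) (η : MulChar F ℂ) {t : F[X] → F} (ht : t 1 = 0) :
    twistedValue φ η t 1 = 1 := by
  simp [twistedValue, ht]

theorem extensionSum_twistedValue [Fintype F] (φ : AddChar F ℂ) (η : MulChar F ℂ) (t : F[X] → F)
    (K : Type*) [Field K] [Fintype K] [Algebra F K] (τ : K → F)
    (hτ : ∀ x, τ x = (Module.finrank F K / (minpoly F x).natDegree) • t (minpoly F x)) :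
    extensionSum (twistedValue φ η t) K = ∑ x : K, η (Algebra.norm F x) * φ (τ x) := by
  refine Finset.sum_congr rfl fun x _ => ?_
  rw [twistedValue, mul_pow, ← map_pow, ← norm_eq_coeff_zero_minpoly_pow, ← AddChar.map_nsmul_eq_pow,
    ← hτ]

theorem monicSum_twistedValue_zero [Fintype F] (φ : AddChar F ℂ) (η : MulChar F ℂ) {t : F[X] → F}
    (ht : t 1 = 0) : monicSum (twistedValue φ η t) 0 = 1 := by
  have : monicsOfDegree F 0 = {1} := by
    ext f
    simp only [mem_monicsOfDegree, Finset.mem_singleton]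
    exact ⟨fun h => h.1.natDegree_eq_zero.mp h.2, by rintro rfl; simp⟩
  rw [monicSum, this, Finset.sum_singleton, twistedValue_one φ η ht]

theorem coeff_monicEquiv_symm_of_lt {n i : ℕ} (h : i < n) (v : Fin n → F) :
    ((monicEquiv F n).symm v).1.coeff i = v ⟨i, h⟩ :=
  coeff_monicEquiv_symm n v ⟨i, h⟩

theorem monicSum_twistedValue_neg_nextCoeff_one [Fintype F] (φ : AddChar F ℂ) (η : MulChar F ℂ) :
    monicSum (twistedValue φ η fun f => -f.nextCoeff) 1 = gaussSum η φ := by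
  rw [monicSum, sum_monicsOfDegree, gaussSum]
  refine Fintype.sum_equiv ((Equiv.funUnique (Fin 1) F).trans (Equiv.neg F)) _ _ fun v => ?_
  have hdeg := ((monicEquiv F 1).symm v).2.2
  rw [twistedValue, nextCoeff_of_natDegree_pos (by rw [hdeg]; simp), hdeg, Nat.sub_self,
    coeff_monicEquiv_symm_of_lt zero_lt_one]
  simp

theorem monicSum_twistedValue_neg_nextCoeff_of_one_lt [Fintype F] {φ : AddChar F ℂ} (hφ : φ ≠ 1)
    (η : MulChar F ℂ) {n : ℕ} (hn : 1 < n) :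
    monicSum (twistedValue φ η fun f => -f.nextCoeff) n = 0 := by
  obtain ⟨c, hc⟩ := AddChar.ne_one_iff.mp hφ
  let e : Fin n := ⟨n - 1, by omega⟩
  have hval (v : Fin n → F) : twistedValue φ η (fun f => -f.nextCoeff) ((monicEquiv F n).symm v).1 =
      η ((-1) ^ n * v ⟨0, by omega⟩) * φ (-v e) := by
    have hdeg := ((monicEquiv F n).symm v).2.2
    rw [twistedValue, nextCoeff_of_natDegree_pos (by rw [hdeg]; omega), hdeg,
      coeff_monicEquiv_symm_of_lt (by omega : 0 < n), coeff_monicEquiv_symm_of_lt (by omega)]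
  have hne : (⟨0, by omega⟩ : Fin n) ≠ e := by
    rw [Ne, Fin.ext_iff]
    simp only [e]
    omega
  rw [monicSum, sum_monicsOfDegree]
  simp_rw [hval]
  refine eq_zero_of_mul_eq_self_left hc ?_
  rw [Finset.mul_sum]
  refine Fintype.sum_equiv (Equiv.subRight (Pi.single e c)) _ _ fun v => ?_
  rw [Equiv.subRight_apply, Pi.sub_apply, Pi.sub_apply, Pi.single_eq_of_ne hne, Pi.single_eq_same,
    sub_zero, neg_sub, sub_eq_add_neg, AddChar.map_add_eq_mul]
  ring

end TwistedSums

section HasseDavenport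
variable {F : Type*} [Field F]

theorem twistedValue_neg_nextCoeff_mul (φ : AddChar F ℂ) (η : MulChar F ℂ) {f g : F[X]}
    (hf : f.Monic) (hg : g.Monic) :
    twistedValue φ η (fun f => -f.nextCoeff) (f * g) =
      twistedValue φ η (fun f => -f.nextCoeff) f * twistedValue φ η (fun f => -f.nextCoeff) g :=
  twistedValue_mul φ η hf hg (by rw [hf.nextCoeff_mul hg, neg_add])

/-- The Hasse–Davenport lifting relation. -/
theorem sum_norm_mul_trace_eq [Fintype F] {φ : AddChar F ℂ} (hφ : φ ≠ 1) (η : MulChar F ℂ)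
    (K : ℕ → Type*) [∀ k, Field (K k)] [∀ k, Fintype (K k)] [∀ k, Algebra F (K k)]
    (hK : ∀ k ≠ 0, Module.finrank F (K k) = k) (n : ℕ) :
    ∑ x : K (n + 1), η (Algebra.norm F x) * φ (Algebra.trace F (K (n + 1)) x) =
      (-1) ^ n * gaussSum η φ ^ (n + 1) := by
  have hext (k : ℕ) : ∑ x : K k, η (Algebra.norm F x) * φ (Algebra.trace F (K k) x) =
      extensionSum (twistedValue φ η fun f => -f.nextCoeff) (K k) :=
    (extensionSum_twistedValue φ η _ (K k) _ trace_eq_nextCoeff_minpoly_nsmul).symm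
  rw [hext]
  have h1 : (1 : F[X]).nextCoeff = 0 := by rw [← C_1, nextCoeff_C_eq_zero]
  have hrec (m : ℕ) := natCast_mul_monicSum_eq_sum_extensionSum
    (fun f g hf hg => twistedValue_neg_nextCoeff_mul φ η hf hg)
    (twistedValue_one φ η (by rw [h1, neg_zero])) K m
    fun k hk => hK k (by rw [Finset.mem_Icc] at hk; omega)
  have hS0 : monicSum (twistedValue φ η fun f => -f.nextCoeff) 0 = 1 :=
    monicSum_twistedValue_zero φ η (by rw [h1, neg_zero])
  induction n with
  | zero =>
    have := hrec 1
    rw [Finset.Icc_self, Finset.sum_singleton, Nat.sub_self, hS0,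
      monicSum_twistedValue_neg_nextCoeff_one] at this
    simpa using this.symm
  | succ n ih =>
    have := hrec (n + 2)
    rw [Finset.sum_Icc_succ_top (by omega), Finset.sum_Icc_succ_top (by omega), Nat.sub_self, hS0,
      show n + 1 + 1 - (n + 1) = 1 by omega, monicSum_twistedValue_neg_nextCoeff_one,
      monicSum_twistedValue_neg_nextCoeff_of_one_lt hφ η (by omega), ih,
      Finset.sum_eq_zero fun k hk => by
        rw [Finset.mem_Icc] at hk
        rw [monicSum_twistedValue_neg_nextCoeff_of_one_lt hφ η (by omega), mul_zero]] at this
    linear_combination -this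

theorem sum_norm_pow_five_mul_trace (φ : AddChar F ℂ) {χ : MulChar F ℂ} (hχ : orderOf χ = 5)
    (η : MulChar F ℂ) (K : Type*) [Field K] [Fintype K] [Algebra F K] :
    ∑ y : K, (η ^ 5) (Algebra.norm F y) * φ (Algebra.trace F K (y ^ 5)) =
      ∑ i ∈ Finset.range 5, ∑ x : K, (χ ^ i * η) (Algebra.norm F x) * φ (Algebra.trace F K x) := by
  classical
  have hfib (x : K) (hx : x ≠ 0) := sum_range_pow_eq_card_fifth_roots
    ((χ : F →* ℂ).comp (Algebra.norm F)) (a := x)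
    (fun a ha => by
      have hN : IsUnit (Algebra.norm F a) := (Algebra.norm_ne_zero_iff.mpr ha).isUnit
      have := MulChar.pow_apply' χ (n := 5) (by norm_num) (Algebra.norm F a)
      rw [← hχ, pow_orderOf_eq_one, MulChar.one_apply hN, hχ] at this
      exact this.symm)
    (by
      have hne : χ ≠ 1 := by
        rintro rfl
        simp at hχ
      obtain ⟨u, hu⟩ := MulChar.ne_one_iff.mp hne
      obtain ⟨a, ha⟩ := FiniteField.norm_surjective F K u
      refine ⟨a, ?_, by simpa [ha] using hu⟩
      rintro rfl
      simp at ha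
      exact u.ne_zero ha.symm) hx
  calc ∑ y : K, (η ^ 5) (Algebra.norm F y) * φ (Algebra.trace F K (y ^ 5))
      = ∑ y : K, η (Algebra.norm F (y ^ 5)) * φ (Algebra.trace F K (y ^ 5)) := by
        simp [MulChar.pow_apply']
    _ = ∑ x : K, ∑ y : K with y ^ 5 = x, η (Algebra.norm F (y ^ 5)) *
          φ (Algebra.trace F K (y ^ 5)) := by
        exact (Finset.sum_fiberwise _ (fun y => y ^ 5) _).symm
    _ = ∑ x : K, ∑ i ∈ Finset.range 5, (χ ^ i * η) (Algebra.norm F x) *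
          φ (Algebra.trace F K x) := by
        refine Finset.sum_congr rfl fun x _ => ?_
        rw [Finset.sum_congr rfl (g := fun _ => η (Algebra.norm F x) * φ (Algebra.trace F K x))
          fun y hy => by rw [(Finset.mem_filter.mp hy).2], Finset.sum_const, nsmul_eq_mul]
        rcases eq_or_ne x 0 with rfl | hx
        · simp [MulChar.map_zero]
        · rw [← hfib x hx, Finset.sum_mul]
          refine Finset.sum_congr rfl fun i _ => ?_
          have hN : IsUnit (Algebra.norm F x) := (Algebra.norm_ne_zero_iff.mpr hx).isUnit
          have := MulChar.pow_apply_coe χ i hN.unit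
          rw [hN.unit_spec] at this
          rw [MulChar.mul_apply, this]
          simp [mul_assoc]
    _ = _ := Finset.sum_comm

theorem newton_identity_five (G S : ℕ → ℂ) (hS0 : S 0 = 1)
    (hS : ∀ n : ℕ, (n : ℂ) * S n = ∑ k ∈ Finset.Icc 1 n,
      (∑ i ∈ Finset.range 5, (-1) ^ (k - 1) * G i ^ k) * S (n - k)) :
    S 5 = ∏ i ∈ Finset.range 5, G i := by
  have h1 := hS 1
  have h2 := hS 2
  have h3 := hS 3
  have h4 := hS 4
  have h5 := hS 5
  simp [Finset.sum_Icc_succ_top, Finset.sum_range_succ, hS0] at h1 h2 h3 h4 h5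
  rw [h1] at h2 h3 h4 h5
  have e2 := (eq_div_iff (two_ne_zero (α := ℂ))).mpr ((mul_comm _ _).trans h2)
  rw [e2] at h3 h4 h5
  have e3 := (eq_div_iff (three_ne_zero (α := ℂ))).mpr ((mul_comm _ _).trans h3)
  rw [e3] at h4 h5
  have e4 := (eq_div_iff (by norm_num : (4 : ℂ) ≠ 0)).mpr ((mul_comm _ _).trans h4)
  rw [e4] at h5
  simp only [Finset.prod_range_succ, Finset.prod_range_zero, one_mul]
  linear_combination h5 / 5

end HasseDavenport

section ProductFormula

theorem sum_fin_succ_arrow {F : Type*} [Fintype F] {M : Type*} [AddCommMonoid M] {n : ℕ}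
    (g : (Fin (n + 1) → F) → M) :
    ∑ v, g v = ∑ a, ∑ v : Fin n → F, g (Fin.cons a v) := by
  rw [← (Fin.consEquiv fun _ => F).sum_comp, Fintype.sum_prod_type]
  rfl

theorem sum_sum_sum_sum_comm {F M : Type*} [Fintype F] [AddCommMonoid M] (g : F → F → F → F → M) :
    ∑ d, ∑ c, ∑ b, ∑ a, g a b c d = ∑ a, ∑ b, ∑ c, ∑ d, g a b c d := by
  rw [Finset.sum_congr rfl fun d _ => Finset.sum_comm_cycle, Finset.sum_comm]
  refine Finset.sum_congr rfl fun a _ => ?_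
  rw [Finset.sum_comm_cycle]
  exact Finset.sum_congr rfl fun b _ => Finset.sum_comm

variable {F : Type*} [Field F] [Fintype F]

theorem monicSum_twistedValue_fifthPowerSum {φ : AddChar F ℂ} (hφ : φ ≠ 1) (h5 : (5 : F) ≠ 0)
    (η : MulChar F ℂ) :
    monicSum (twistedValue φ (η ^ 5) fifthPowerSum) 5 =
      η (5 ^ 5)⁻¹ * (Fintype.card F : ℂ) ^ 2 * gaussSum (η ^ 5) φ := by
  classical
  have hprim := AddChar.IsPrimitive.of_ne_one hφ
  have hval (v : Fin 5 → F) : twistedValue φ (η ^ 5) fifthPowerSum ((monicEquiv F 5).symm v).1 =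
      (η ^ 5) (-v 0) * φ (5 * v 4 ^ 3 * v 3 - v 4 ^ 5 - 5 * v 4 * v 3 ^ 2 - 5 * v 4 ^ 2 * v 2
        + 5 * v 3 * v 2 + 5 * v 4 * v 1 - 5 * v 0) := by
    have hdeg := ((monicEquiv F 5).symm v).2.2
    rw [twistedValue, hdeg, fifthPowerSum]
    simp only [coeff_reverse, hdeg]
    simp only [revAt_le (by norm_num : 1 ≤ 5), revAt_le (by norm_num : 2 ≤ 5),
      revAt_le (by norm_num : 3 ≤ 5), revAt_le (by norm_num : 4 ≤ 5), revAt_le le_rfl,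
      Nat.reduceSub, coeff_monicEquiv_symm_of_lt (by norm_num : 0 < 5),
      coeff_monicEquiv_symm_of_lt (by norm_num : 1 < 5),
      coeff_monicEquiv_symm_of_lt (by norm_num : 2 < 5),
      coeff_monicEquiv_symm_of_lt (by norm_num : 3 < 5),
      coeff_monicEquiv_symm_of_lt (by norm_num : 4 < 5)]
    congr 2
    simp [Odd.neg_pow (show Odd 5 by decide)]
  calc monicSum (twistedValue φ (η ^ 5) fifthPowerSum) 5
      = ∑ e : F, ∑ d : F, ∑ c : F, ∑ b : F, ∑ a : F, (η ^ 5) (-e) *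
          φ (5 * a ^ 3 * b - a ^ 5 - 5 * a * b ^ 2 - 5 * a ^ 2 * c
            + 5 * b * c + 5 * a * d - 5 * e) := by
        rw [monicSum, sum_monicsOfDegree]
        simp_rw [hval, sum_fin_succ_arrow]
        simp only [Fintype.sum_unique]
        rfl
    _ = ∑ e : F, ∑ a : F, ∑ b : F, ∑ c : F, (η ^ 5) (-e) *
          φ (5 * a ^ 3 * b - a ^ 5 - 5 * a * b ^ 2 - 5 * a ^ 2 * c
            + 5 * b * c - 5 * e) * ∑ d : F, φ (d * (5 * a)) := by
        refine Finset.sum_congr rfl fun e _ => ?_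
        rw [sum_sum_sum_sum_comm]
        simp_rw [Finset.mul_sum, mul_assoc, ← AddChar.map_add_eq_mul]
        refine Finset.sum_congr rfl fun a _ => Finset.sum_congr rfl fun b _ =>
          Finset.sum_congr rfl fun c _ => Finset.sum_congr rfl fun d _ => ?_
        congr 2
        ring
    _ = ∑ e : F, ∑ b : F, (η ^ 5) (-e) * φ (-5 * e) * (Fintype.card F * ∑ c : F, φ (c * (5 * b))) := by
        refine Finset.sum_congr rfl fun e _ => ?_
        rw [Fintype.sum_eq_single 0 fun a ha => by simp [AddChar.sum_mulShift _ hprim, h5, ha]]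
        refine Finset.sum_congr rfl fun b _ => ?_
        simp_rw [Finset.mul_sum]
        refine Finset.sum_congr rfl fun c _ => ?_
        rw [← Finset.mul_sum, AddChar.sum_mulShift _ hprim, if_pos (mul_zero _),
          show 5 * 0 ^ 3 * b - 0 ^ 5 - 5 * 0 * b ^ 2 - 5 * 0 ^ 2 * c + 5 * b * c - 5 * e =
            -5 * e + c * (5 * b) by ring, AddChar.map_add_eq_mul]
        ring
    _ = ∑ e : F, (η ^ 5) (-e) * φ (-5 * e) * (Fintype.card F : ℂ) ^ 2 := by
        refine Finset.sum_congr rfl fun e _ => ?_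
        simp_rw [AddChar.sum_mulShift _ hprim]
        simp only [mul_eq_zero, h5, false_or, Nat.cast_ite, Nat.cast_zero, mul_ite, mul_zero,
          Finset.sum_ite_eq', Finset.mem_univ, if_true]
        ring
    _ = η (5 ^ 5)⁻¹ * (Fintype.card F : ℂ) ^ 2 * gaussSum (η ^ 5) φ := by
        rw [gaussSum, Finset.mul_sum]
        refine Fintype.sum_equiv (Equiv.mulLeft₀ (-5) (neg_ne_zero.mpr h5)) _ _ fun e => ?_
        rw [Equiv.mulLeft₀_apply, show η (5 ^ 5)⁻¹ = (η ^ 5) 5⁻¹ by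
            rw [MulChar.pow_apply' _ (by norm_num), ← map_pow, inv_pow],
          show -e = 5⁻¹ * (-5 * e) by field_simp, map_mul]
        ring

/-- The Hasse–Davenport product formula for characters of order five. -/
theorem prod_gaussSum_eq {φ : AddChar F ℂ} (hφ : φ ≠ 1) (h5 : (5 : F) ≠ 0) {χ : MulChar F ℂ}
    (hχ : orderOf χ = 5) (η : MulChar F ℂ) :
    ∏ i ∈ Finset.range 5, gaussSum (χ ^ i * η) φ =
      η (5 ^ 5)⁻¹ * (Fintype.card F : ℂ) ^ 2 * gaussSum (η ^ 5) φ := by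
  rw [← monicSum_twistedValue_fifthPowerSum hφ h5]
  obtain ⟨p, hp⟩ := CharP.exists F
  have : Fact p.Prime := ⟨CharP.char_is_prime F p⟩
  let K (k : ℕ) := FiniteField.Extension F p (k - 1 + 1)
  have (k : ℕ) : Fintype (K k) := Fintype.ofFinite _
  have hK (k : ℕ) (hk : k ≠ 0) : Module.finrank F (K k) = k := by
    rw [FiniteField.finrank_extension]
    omega
  refine (newton_identity_five _ (monicSum (twistedValue φ (η ^ 5) fifthPowerSum))
    (monicSum_twistedValue_zero φ _ fifthPowerSum_one) fun n => ?_).symm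
  rw [natCast_mul_monicSum_eq_sum_extensionSum
    (fun f g hf hg => twistedValue_mul φ _ hf hg (fifthPowerSum_mul hf hg))
    (twistedValue_one φ _ fifthPowerSum_one) K n
    fun k hk => hK k (by rw [Finset.mem_Icc] at hk; omega)]
  refine Finset.sum_congr rfl fun k hk => ?_
  obtain ⟨k, rfl⟩ := Nat.exists_eq_add_of_le' (Finset.mem_Icc.mp hk).1
  rw [extensionSum_twistedValue φ _ _ (K (k + 1)) _ trace_pow_five_eq_nsmul,
    sum_norm_pow_five_mul_trace φ hχ]
  simp_rw [sum_norm_mul_trace_eq hφ _ K hK]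
  simp

end ProductFormula

end FunctionField

section CharacterSums
variable {F : Type*} [Field F] [Fintype F]

theorem gaussSum'_eq_gaussSum (φ : AddChar F ℂ) (χ : MulChar F ℂ) :
    gaussSum' φ χ = gaussSum χ φ := by
  classical
  have h : ∀ x ∉ Finset.univ.erase (0 : F), χ x * φ x = 0 := fun x hx => by
    have : x = 0 := by simpa using hx
    rw [this, MulChar.map_zero, zero_mul]
  rw [gaussSum', gaussSum, ← Finset.sum_subset (Finset.subset_univ _) fun x _ hx => h x hx]
  refine Finset.sum_bij (fun u _ => (u : F)) (fun u _ => by simp) (fun u _ v _ h => Units.ext h)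
    (fun x hx => ?_) fun u _ => mul_comm _ _
  exact ⟨Units.mk0 x (Finset.ne_of_mem_erase hx), Finset.mem_univ _, rfl⟩

theorem sum_mulChar_apply [DecidableEq F] (u : F) :
    ∑ η : MulChar F ℂ, η u = if u = 1 then (Fintype.card F : ℂ) - 1 else 0 := by
  split_ifs with hu
  · subst hu
    have h := MulChar.card_eq_card_units_of_hasEnoughRootsOfUnity F ℂ
    rw [Nat.card_eq_fintype_card, Nat.card_eq_fintype_card, Fintype.card_units] at h
    simp [h, Nat.cast_sub Fintype.card_pos]
  · rcases eq_or_ne u 0 with rfl | h0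
    · simp [MulChar.map_zero]
    · obtain ⟨η₀, hη₀⟩ := MulChar.exists_apply_ne_one_of_hasEnoughRootsOfUnity F ℂ hu
      refine eq_zero_of_mul_eq_self_left hη₀ ?_
      rw [Finset.mul_sum]
      exact Fintype.sum_equiv (Equiv.mulLeft η₀) _ _ fun η => by simp

theorem sum_mul_sum_mul_sum_mul_sum {F : Type*} [Fintype F] (A B C D : F → ℂ) :
    (∑ a, A a) * (∑ b, B b) * ((∑ c, C c) * ∑ d, D d) =
      ∑ b, ∑ c, ∑ d, ∑ a, A a * B b * (C c * D d) := by
  simp_rw [← Finset.sum_mul, mul_comm _ (B _), ← Finset.mul_sum, ← Finset.sum_mul]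
  ring

theorem sum_gaussSum_mul_gaussSum [DecidableEq F] (φ : AddChar F ℂ) (ρ : MulChar F ℂ) (l : F) :
    ∑ η : MulChar F ℂ, gaussSum (ρ * η) φ * gaussSum (ρ⁻¹ * η) φ * gaussSum η⁻¹ φ ^ 2 * η l⁻¹ =
      ((Fintype.card F : ℂ) - 1) * ∑ b, ∑ c, ∑ d, ∑ a, if a * b * (c * d * l)⁻¹ = 1 then
        ρ a * ρ⁻¹ b * φ (a + b + c + d) else 0 := by
  have hη (η : MulChar F ℂ) :
      gaussSum (ρ * η) φ * gaussSum (ρ⁻¹ * η) φ * gaussSum η⁻¹ φ ^ 2 * η l⁻¹ =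
        ∑ b, ∑ c, ∑ d, ∑ a, ρ a * ρ⁻¹ b * φ (a + b + c + d) * η (a * b * (c * d * l)⁻¹) := by
    rw [sq]
    simp_rw [gaussSum]
    rw [sum_mul_sum_mul_sum_mul_sum]
    simp_rw [Finset.sum_mul]
    refine Finset.sum_congr rfl fun b _ => Finset.sum_congr rfl fun c _ =>
      Finset.sum_congr rfl fun d _ => Finset.sum_congr rfl fun a _ => ?_
    simp only [MulChar.mul_apply, AddChar.map_add_eq_mul, MulChar.inv_apply' η, mul_inv, map_mul]
    ring
  simp_rw [hη]
  rw [Finset.sum_comm, Finset.mul_sum]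
  refine Finset.sum_congr rfl fun b _ => ?_
  rw [Finset.sum_comm, Finset.mul_sum]
  refine Finset.sum_congr rfl fun c _ => ?_
  rw [Finset.sum_comm, Finset.mul_sum]
  refine Finset.sum_congr rfl fun d _ => ?_
  rw [Finset.sum_comm, Finset.mul_sum]
  refine Finset.sum_congr rfl fun a _ => ?_
  rw [← Finset.mul_sum, sum_mulChar_apply]
  split_ifs <;> ring

theorem sum_eq_sum_mul_add [DecidableEq F] (φ : AddChar F ℂ) {ρ : MulChar F ℂ} (hρ : ρ ≠ 1)
    {l : F} (hl : l ≠ 0) (b : F) :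
    (∑ c, ∑ d, ∑ a, if a * b * (c * d * l)⁻¹ = 1 then ρ a * ρ⁻¹ b * φ (a + b + c + d) else 0) =
      ∑ c, ∑ d, ρ (l * c * d) * φ (b * (l * c * d + 1 + c + d)) := by
  rcases eq_or_ne b 0 with rfl | hb
  · simp [← Finset.mul_sum, MulChar.sum_eq_zero_of_ne_one hρ]
  · rw [← Equiv.sum_comp (Equiv.mulLeft₀ b hb)]
    refine Finset.sum_congr rfl fun c _ => ?_
    rw [← Equiv.sum_comp (Equiv.mulLeft₀ b hb)]
    refine Finset.sum_congr rfl fun d _ => ?_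
    rw [Fintype.sum_eq_single (b * (l * c * d)) fun a ha => if_neg fun h => ha ?_]
    · simp only [Equiv.mulLeft₀_apply]
      rcases eq_or_ne c 0 with rfl | hc
      · simp [MulChar.map_zero]
      rcases eq_or_ne d 0 with rfl | hd
      · simp [MulChar.map_zero]
      rw [if_pos (by field_simp), map_mul, mul_right_comm (ρ b), ← MulChar.mul_apply,
        mul_inv_cancel, MulChar.one_apply hb.isUnit, one_mul]
      congr 2
      ring
    · simp only [Equiv.mulLeft₀_apply] at h
      have : (b * c * (b * d) * l) ≠ 0 := fun h0 => by simp [h0] at h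
      rw [mul_inv_eq_one₀ this] at h
      apply mul_right_cancel₀ hb
      rw [h]
      ring

theorem sum_apply_mul_eq {φ : AddChar F ℂ} (hφ : φ ≠ 1) {ρ : MulChar F ℂ} (hρ : ρ ≠ 1)
    (l : F) :
    ∑ b, ∑ c, ∑ d, ρ (l * c * d) * φ (b * (l * c * d + 1 + c + d)) =
      Fintype.card F * ∑ c, ρ (l * c * (-(1 + c) / (1 + l * c))) := by
  classical
  rw [Finset.sum_comm, Finset.mul_sum]
  refine Finset.sum_congr rfl fun c _ => ?_
  rw [Finset.sum_comm]
  simp_rw [← Finset.mul_sum, AddChar.sum_mulShift _ (AddChar.IsPrimitive.of_ne_one hφ)]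
  by_cases h : 1 + l * c = 0
  · simp only [h, div_zero, mul_zero, MulChar.map_zero]
    have hd (d : F) : l * c * d + 1 + c + d = 1 + c := by linear_combination d * h
    simp_rw [hd, map_mul, mul_assoc, ← Finset.mul_sum, ← Finset.sum_mul,
      MulChar.sum_eq_zero_of_ne_one hρ]
    simp
  · rw [Fintype.sum_eq_single (-(1 + c) / (1 + l * c)) fun d hd => ?_]
    · rw [if_pos (by field_simp; ring), mul_comm]
    · rw [if_neg fun h0 => hd ?_]
      · simp
      · rw [eq_div_iff h]
        linear_combination h0

theorem sum_gaussSum_eq {φ : AddChar F ℂ} (hφ : φ ≠ 1) {ρ : MulChar F ℂ} (hρ : ρ ≠ 1)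
    {l : F} (hl : l ≠ 0) (hρl : ρ l = 1) (hρ1 : ρ (-1) = 1) :
    ∑ η : MulChar F ℂ, gaussSum (ρ * η) φ * gaussSum (ρ⁻¹ * η) φ * gaussSum η⁻¹ φ ^ 2 * η l⁻¹ =
      ((Fintype.card F : ℂ) - 1) * Fintype.card F * ∑ x, ρ (x * (x - l)) * ρ⁻¹ (1 - x) := by
  classical
  rw [sum_gaussSum_mul_gaussSum]
  simp_rw [sum_eq_sum_mul_add φ hρ hl]
  rw [sum_apply_mul_eq hφ hρ, mul_assoc]
  congr 2
  refine Fintype.sum_equiv (Equiv.mulLeft₀ (-l) (neg_ne_zero.mpr hl)) _ _ fun c => ?_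
  have h : -l * c * (-l * c - l) * (1 - -l * c)⁻¹ =
      -1 * l * (l * c * (-(1 + c) / (1 + l * c))) := by
    rw [show 1 - -l * c = 1 + l * c by ring, div_eq_mul_inv]
    ring
  rw [Equiv.mulLeft₀_apply, MulChar.inv_apply', ← map_mul, h, map_mul ρ (-1 * l),
    map_mul ρ (-1), hρl, hρ1, one_mul, one_mul]

end CharacterSums

section HypergeometricSums
variable {F : Type*} [Field F] [Fintype F]

theorem gaussSum_mul_gaussSum_inv_sq {φ : AddChar F ℂ} (hφ : φ ≠ 1) {η : MulChar F ℂ}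
    (hη : η ≠ 1) : (gaussSum η φ * gaussSum η⁻¹ φ) ^ 2 = (Fintype.card F : ℂ) ^ 2 := by
  have h := gaussSum_mul_gaussSum_eq_card hη (AddChar.IsPrimitive.of_ne_one hφ)
  have h1 : η⁻¹ (-1) ^ 2 = 1 := by rw [← map_pow]; simp
  rw [← mul_gaussSum_inv_eq_gaussSum η⁻¹ φ, mul_left_comm, h, mul_pow, h1, one_mul]

theorem gaussSum_ne_zero {φ : AddChar F ℂ} (hφ : φ ≠ 1) (η : MulChar F ℂ) :
    gaussSum η φ ≠ 0 := by
  have hq : (Fintype.card F : ℂ) ≠ 0 := Nat.cast_ne_zero.mpr Fintype.card_ne_zero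
  rcases eq_or_ne η 1 with rfl | hη
  · rw [gaussSum_one_left hφ]
    simp
  · exact gaussSum_ne_zero_of_nontrivial hq hη (AddChar.IsPrimitive.of_ne_one hφ)

theorem zNum_eq (χ η : MulChar F ℂ) (s : Fin 5 → ℤ) [DecidableEq (MulChar F ℂ)] :
    zNum χ η s = ∑ j, if χ ^ s j * η = 1 then 1 else 0 := by
  rw [zNum, Finset.card_filter]
  congr!

theorem card_zpow_eq_gaussSum_sq {φ : AddChar F ℂ} (hφ : φ ≠ 1) {χ : MulChar F ℂ} {i j : ℤ}
    (hi : χ ^ i ≠ 1) (hj : χ ^ j ≠ 1) (hij : χ ^ i ≠ χ ^ j) (η : MulChar F ℂ) :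
    (Fintype.card F : ℂ) ^ ((5 : ℤ) - zNum χ η ![0, 0, 0, i, j] - deltaNum χ η ![0, 0, 0, i, j]) =
      (Fintype.card F : ℂ) ^ 2 * (gaussSum η φ * gaussSum η⁻¹ φ) ^ 2 := by
  classical
  rcases eq_or_ne η 1 with rfl | hη
  · rw [deltaNum, zNum_eq, Fin.sum_univ_five]
    simp [hi, hj, gaussSum_one_left, hφ]
  · rw [gaussSum_mul_gaussSum_inv_sq hφ hη, ← pow_add, deltaNum, zNum_eq, Fin.sum_univ_five]
    by_cases h1 : χ ^ i * η = 1
    · have h2 : χ ^ j * η ≠ 1 := fun h2 => hij (mul_right_cancel (h1.trans h2.symm))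
      simp [hη, h1, h2]
    · by_cases h2 : χ ^ j * η = 1
      · simp [hη, h1, h2]
      · simp [hη, h1, h2]

theorem Ntuple_eq_sum_gaussSum {φ : AddChar F ℂ} (hφ : φ ≠ 1) {χ : MulChar F ℂ} {i j : ℤ}
    (hi : χ ^ i ≠ 1) (hj : χ ^ j ≠ 1) (hij : χ ^ i ≠ χ ^ j) (ρ : MulChar F ℂ)
    (hprod : ∀ η, gaussSum η φ * gaussSum (χ ^ i * η) φ * gaussSum (χ ^ j * η) φ *
      (gaussSum (ρ * η) φ * gaussSum (ρ⁻¹ * η) φ) =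
        η (5 ^ 5)⁻¹ * (Fintype.card F : ℂ) ^ 2 * gaussSum (η ^ 5) φ) (ψ : F) :
    Ntuple φ χ ψ ![0, 0, 0, i, j] = 1 / ((Fintype.card F : ℂ) - 1) *
      ∑ η : MulChar F ℂ, gaussSum (ρ * η) φ * gaussSum (ρ⁻¹ * η) φ * gaussSum η⁻¹ φ ^ 2 *
        η (ψ ^ 5)⁻¹ := by
  rw [Ntuple]
  congr 1
  refine Finset.sum_congr rfl fun η _ => ?_
  simp_rw [gaussSum'_eq_gaussSum]
  rw [card_zpow_eq_gaussSum_sq hφ hi hj hij, mul_pow (5 : F), mul_inv, map_mul, Fin.prod_univ_five]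
  have h0 := gaussSum_ne_zero hφ η
  have h1 := gaussSum_ne_zero hφ (χ ^ i * η)
  have h2 := gaussSum_ne_zero hφ (χ ^ j * η)
  have h := hprod η
  simp only [Matrix.cons_val, zpow_zero, one_mul]
  generalize η (5 ^ 5)⁻¹ = u at h ⊢
  generalize η (ψ ^ 5)⁻¹ = v
  field_simp
  linear_combination (-gaussSum η⁻¹ φ ^ 2 * v) * h

theorem sum_range_five_pow_eq_card {χ : MulChar F ℂ} (hχ : orderOf χ = 5) [DecidableEq F] (a : F) :
    ∑ i ∈ Finset.range 5, χ a ^ i = (Finset.univ.filter fun y : F => y ^ 5 = a).card := by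
  rcases eq_or_ne a 0 with rfl | ha
  · simp [Finset.sum_range_succ, MulChar.map_zero, Finset.filter_eq']
  refine sum_range_pow_eq_card_fifth_roots (χ : F →* ℂ) (fun b hb => ?_) ?_ ha
  · have := MulChar.pow_apply' χ (n := 5) (by norm_num) b
    rw [← hχ, pow_orderOf_eq_one, MulChar.one_apply hb.isUnit, hχ] at this
    exact this.symm
  · have hne : χ ≠ 1 := by
      rintro rfl
      simp at hχ
    obtain ⟨u, hu⟩ := MulChar.ne_one_iff.mp hne
    exact ⟨u, u.ne_zero, hu⟩

end HypergeometricSums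

section CurveCount
variable {F : Type*} [Field F] [Fintype F]

theorem natCard_curve_eq_sum {χ : MulChar F ℂ} (hχ : orderOf χ = 5) (l : F) :
    (Nat.card {pt : F × F // pt.2 ^ 5 = pt.1 ^ 2 * (1 - pt.1) ^ 3 * (pt.1 - l) ^ 2} : ℂ) =
      Fintype.card F + ∑ i ∈ Finset.Icc 1 4,
        ∑ x, (χ ^ (2 * i)) (x * (x - l)) * (χ ^ (2 * i))⁻¹ (1 - x) := by
  classical
  have hcard : Nat.card {pt : F × F // pt.2 ^ 5 = pt.1 ^ 2 * (1 - pt.1) ^ 3 * (pt.1 - l) ^ 2} =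
      ∑ x : F, (Finset.univ.filter fun y : F =>
        y ^ 5 = x ^ 2 * (1 - x) ^ 3 * (x - l) ^ 2).card := by
    rw [Nat.card_eq_fintype_card, Fintype.card_subtype, Finset.card_filter,
      Fintype.sum_prod_type]
    simp_rw [Finset.card_filter]
  rw [hcard, Nat.cast_sum]
  simp_rw [← sum_range_five_pow_eq_card hχ]
  rw [Finset.sum_comm, Finset.range_eq_Ico, Finset.sum_eq_sum_Ico_succ_bot (by norm_num)]
  congr 1
  · simp
  · refine Finset.sum_congr rfl fun i hi => Finset.sum_congr rfl fun x _ => ?_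
    have hi0 : i ≠ 0 := by
      rw [Finset.mem_Icc] at hi
      omega
    have h3 : χ (1 - x) ^ 3 = χ⁻¹ (1 - x) ^ 2 := by
      rw [← MulChar.pow_apply' _ (by norm_num), ← MulChar.pow_apply' _ (by norm_num)]
      congr 1
      rw [inv_pow, eq_inv_iff_mul_eq_one, ← pow_add]
      have h := pow_orderOf_eq_one χ
      rwa [hχ] at h
    rw [← inv_pow, MulChar.pow_apply' _ (by omega), MulChar.pow_apply' _ (by omega)]
    simp only [map_mul, map_pow, h3]
    ring

end CurveCount

/-- Let `F` be a finite field with `q ≡ 1 (mod 5)` elements of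
characteristic `p ≠ 5`, let `ψ ∈ F*`, and let `χ` be a multiplicative character of `F` of
order `5`. Let `A_ψ` be the affine curve `y⁵ = x²(1-x)³(x-ψ⁵)²`. Then
`#A_ψ(F_q) = q + (2/q)(N_{(0,0,0,1,4),χ}(q) + N_{(0,0,0,2,3),χ}(q))`. -/
theorem stmt_0 {F : Type*} [Field F] [Fintype F] (hchar : ringChar F ≠ 5)
    (hq : Fintype.card F % 5 = 1) (ψ : F) (hψ : ψ ≠ 0)
    (φ : AddChar F ℂ) (hφ : φ ≠ 1) (χ : MulChar F ℂ) (hχ : orderOf χ = 5) :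
    (Nat.card {pt : F × F //
        pt.2 ^ 5 = pt.1 ^ 2 * (1 - pt.1) ^ 3 * (pt.1 - ψ ^ 5) ^ 2} : ℂ) =
      (Fintype.card F : ℂ) +
        (2 / (Fintype.card F : ℂ)) *
          (Ntuple φ χ ψ ![0, 0, 0, 1, 4] + Ntuple φ χ ψ ![0, 0, 0, 2, 3]) := by
  have h5 : (5 : F) ≠ 0 := fun h => by
    have hcard := Nat.cast_card_eq_zero F
    rw [← Nat.div_add_mod (Fintype.card F) 5, hq] at hcard
    simp [h] at hcard
  have hχ5 : χ ^ 5 = 1 := by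
    rw [← hχ, pow_orderOf_eq_one]
  have hχne {k : ℕ} (hk : ¬ 5 ∣ k) : χ ^ k ≠ 1 := fun h =>
    hk (hχ ▸ orderOf_dvd_of_pow_eq_one h)
  have hinv {j k : ℕ} (h : χ ^ (j + k) = 1) : (χ ^ j)⁻¹ = χ ^ k := by
    rw [inv_eq_iff_mul_eq_one, ← pow_add, h]
  have hq0 : (Fintype.card F : ℂ) ≠ 0 := Nat.cast_ne_zero.mpr Fintype.card_ne_zero
  have hq1 : (Fintype.card F : ℂ) - 1 ≠ 0 :=
    sub_ne_zero.mpr (Nat.cast_ne_one.mpr Fintype.one_lt_card.ne')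
  let J (ρ : MulChar F ℂ) : ℂ := ∑ x, ρ (x * (x - ψ ^ 5)) * ρ⁻¹ (1 - x)
  have hsum {k : ℕ} (hk : ¬ 5 ∣ k) := by
    have h (a : F) (ha : a ≠ 0) : (χ ^ k) (a ^ 5) = 1 := by
      rw [map_pow, ← MulChar.pow_apply' _ (by norm_num), ← pow_mul, mul_comm, pow_mul, hχ5, one_pow,
        MulChar.one_apply ha.isUnit]
    exact sum_gaussSum_eq hφ (hχne hk) (pow_ne_zero 5 hψ) (h ψ hψ)
      (by simpa [Odd.neg_pow (show Odd 5 by decide)] using h (-1) (by simp))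
  have hJ {j k : ℕ} (hj : ¬ 5 ∣ j) (h : χ ^ (j + k) = 1) (hk : ¬ 5 ∣ k) : J (χ ^ k) = J (χ ^ j) := by
    have h1 := hsum hj
    have h2 := hsum hk
    rw [hinv h] at h1
    rw [hinv (by rwa [add_comm]), Finset.sum_congr rfl fun η _ => by
      rw [mul_comm (gaussSum (χ ^ k * η) φ)], h1] at h2
    simp only [J, hinv h, hinv ((add_comm k j).symm ▸ h)]
    exact (mul_left_cancel₀ (mul_ne_zero hq1 hq0) h2).symm
  have hzpow (j : ℕ) (hj : ¬ 5 ∣ j) : χ ^ (j : ℤ) ≠ 1 := by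
    rw [zpow_natCast]
    exact hχne hj
  have hzpowne (j k : ℕ) (hk : ¬ 5 ∣ k) : χ ^ (j : ℤ) ≠ χ ^ ((j + k : ℕ) : ℤ) := by
    rw [zpow_natCast, zpow_natCast, pow_add, ne_eq, left_eq_mul]
    exact hχne hk
  have hN14 : Ntuple φ χ ψ ![0, 0, 0, 1, 4] = Fintype.card F * J (χ ^ 2) := by
    rw [Ntuple_eq_sum_gaussSum hφ (i := 1) (j := 4) (hzpow 1 (by decide)) (hzpow 4 (by decide))
      ?_ (χ ^ 2) ?_, hsum (by decide)]
    · field_simp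
      rfl
    · exact hzpowne 1 3 (by decide)
    · intro η
      rw [← prod_gaussSum_eq hφ h5 hχ η, hinv (j := 2) (k := 3) hχ5]
      simp only [Finset.prod_range_succ, Finset.prod_range_zero, pow_zero, pow_one, one_mul,
        zpow_ofNat]
      ring
  have hN23 : Ntuple φ χ ψ ![0, 0, 0, 2, 3] = Fintype.card F * J (χ ^ 1) := by
    rw [Ntuple_eq_sum_gaussSum hφ (i := 2) (j := 3) (hzpow 2 (by decide)) (hzpow 3 (by decide))
      ?_ (χ ^ 1) ?_, hsum (by decide)]
    · field_simp
      rfl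
    · exact hzpowne 2 1 (by decide)
    · intro η
      rw [← prod_gaussSum_eq hφ h5 hχ η, hinv (j := 1) (k := 4) hχ5]
      simp only [Finset.prod_range_succ, Finset.prod_range_zero, pow_zero, pow_one, one_mul,
        zpow_ofNat]
      ring
  have h6 : χ ^ 6 = χ ^ 1 := by rw [pow_succ, hχ5, one_mul, pow_one]
  have h8 : χ ^ 8 = χ ^ 3 := by rw [show 8 = 5 + 3 from rfl, pow_add, hχ5, one_mul]
  have h4 : J (χ ^ 4) = J (χ ^ 1) := hJ (by decide) hχ5 (by decide)
  have h3 : J (χ ^ 3) = J (χ ^ 2) := hJ (by decide) hχ5 (by decide)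
  have hcurve := natCard_curve_eq_sum hχ (ψ ^ 5)
  change _ = _ + ∑ i ∈ Finset.Icc 1 4, J (χ ^ (2 * i)) at hcurve
  rw [hcurve, hN14, hN23, show Finset.Icc 1 4 = {1, 2, 3, 4} from rfl]
  simp only [Finset.mem_insert, Finset.mem_singleton, Finset.sum_insert, Finset.sum_singleton,
    Nat.reduceMul, Nat.reduceEqDiff, or_self, not_false_eq_true, h6, h8, h4, h3]
  field_simp
  ring
end

section
/- Suppose p ≢ 1 (mod 5) and q is a power of p with q ≡ 1 (mod 5). Then q is a perfect square, and if q' denotes the integer square root of q satisfying q' ≡ 1 (mod 5), the number of pairs (x,y) ∈ F_q × F_q with y^5 = x^4(1-x)^3 equals q − 4q'. -/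
open Polynomial in
/-- A rational integer that is divisible by `μ - 1` in `ℤ[μ]`, where `μ` is a primitive `ℓ`-th root
of unity for a prime `ℓ`, is divisible by `ℓ`. -/
lemma IsPrimitiveRoot.dvd_of_intCast_eq_mul_sub_one {K : Type*} [Field K] [CharZero K] {ℓ : ℕ}
    [hℓ : Fact ℓ.Prime] {μ : K} (hμ : IsPrimitiveRoot μ ℓ) {n : ℤ} {z : K}
    (hz : z ∈ Algebra.adjoin ℤ {μ}) (h : (n : K) = z * (μ - 1)) : (ℓ : ℤ) ∣ n := by
  rw [Algebra.adjoin_singleton_eq_range_aeval] at hz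
  obtain ⟨g, rfl⟩ := hz
  have hint : IsIntegral ℤ μ := hμ.isIntegral hℓ.out.pos
  have hdvd : minpoly ℤ μ ∣ C n - g * (X - 1) :=
    minpoly.isIntegrallyClosed_dvd hint (by simp_all)
  rw [← cyclotomic_eq_minpoly hμ hℓ.out.pos] at hdvd
  simpa using eval_dvd (x := 1) hdvd

section FiniteField

variable {F : Type*} [Field F] [Fintype F]

/-- A multiplicative character of prime order `ℓ` takes the value `1` at a nonzero `a` only if `a`
is an `ℓ`-th power. -/
lemma MulChar.exists_pow_eq_of_apply_eq_one {R : Type*} [CommRing R] {ℓ : ℕ} [hℓ : Fact ℓ.Prime]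
    {χ : MulChar F R} (hχ : orderOf χ = ℓ) {a : F} (ha : a ≠ 0) (h : χ a = 1) :
    ∃ b, b ^ ℓ = a := by
  obtain ⟨g, hg⟩ := IsCyclic.exists_generator (α := Fˣ)
  obtain ⟨k, hk⟩ := (mem_powers_iff_mem_zpowers (x := g)).mpr (hg (Units.mk0 a ha))
  have hk' : (g : F) ^ k = a := by simpa using congrArg Units.val hk
  have hord : orderOf (χ g) = ℓ := by
    refine orderOf_eq_prime ?_ fun h1 ↦ ?_
    · rw [← MulChar.pow_apply_coe, ← hχ, pow_orderOf_eq_one, MulChar.one_apply_coe]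
    · have : χ = 1 := (MulChar.eq_iff hg _ _).mpr (by rw [h1, MulChar.one_apply_coe])
      exact hℓ.out.one_lt.ne' (by rw [← hχ, this, orderOf_one])
  obtain ⟨m, rfl⟩ : ℓ ∣ k := by
    rw [← hord]
    exact orderOf_dvd_of_pow_eq_one (by rw [← map_pow, hk', h])
  exact ⟨(g : F) ^ m, by rw [← pow_mul, mul_comm, hk']⟩

lemma FiniteField.exists_isPrimitiveRoot {n : ℕ} (hn : n ∣ Fintype.card F - 1) :
    ∃ ζ : F, IsPrimitiveRoot ζ n := by
  classical
  obtain ⟨g, hg⟩ := IsCyclic.exists_generator (α := Fˣ)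
  have hord := IsPrimitiveRoot.orderOf g
  rw [orderOf_eq_card_of_forall_mem_zpowers hg, Nat.card_eq_fintype_card,
    Fintype.card_units] at hord
  obtain ⟨m, hm⟩ := hn
  have hpos : 0 < Fintype.card F - 1 := Nat.sub_pos_of_lt Fintype.one_lt_card
  exact ⟨_, (hord.pow hpos (hm.trans (mul_comm _ _))).map_of_injective
    (f := Units.coeHom F) Units.val_injective⟩

/-- The number of `ℓ`-th roots of `a` in a finite field, in terms of a multiplicative character
of prime order `ℓ`. -/
lemma MulChar.card_pow_eq {R : Type*} [CommRing R] [IsDomain R] {ℓ : ℕ} [hℓ : Fact ℓ.Prime]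
    {χ : MulChar F R} (hχ : orderOf χ = ℓ) (a : F) :
    (Nat.card {y : F // y ^ ℓ = a} : R) = 1 + ∑ i ∈ Finset.range (ℓ - 1), (χ ^ (i + 1)) a := by
  classical
  have hℓ0 : 0 < ℓ := hℓ.out.pos
  rcases eq_or_ne a 0 with rfl | ha
  · have (y : F) : y ^ ℓ = 0 ↔ y = 0 := pow_eq_zero_iff hℓ0.ne'
    simp [this]
  have hdvd : ℓ ∣ Fintype.card F - 1 := hχ ▸ MulChar.orderOf_dvd_card_sub_one F χ
  obtain ⟨ζ, hζ⟩ := FiniteField.exists_isPrimitiveRoot hdvd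
  have hcard : Nat.card {y : F // y ^ ℓ = a} = if ∃ b, b ^ ℓ = a then ℓ else 0 := by
    trans Multiset.card (Polynomial.nthRoots ℓ a)
    · rw [← Multiset.toFinset_card_of_nodup (hζ.nthRoots_nodup ha)]
      exact Nat.subtype_card _ fun y ↦ by simp [Polynomial.mem_nthRoots hℓ0]
    · convert hζ.card_nthRoots a
  have hsum : 1 + ∑ i ∈ Finset.range (ℓ - 1), (χ ^ (i + 1)) a
      = ∑ i ∈ Finset.range ℓ, (χ a) ^ i := by
    obtain ⟨m, rfl⟩ := Nat.exists_eq_add_of_lt hℓ0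
    simp [Finset.sum_range_succ', MulChar.pow_apply' _ (Nat.succ_ne_zero _), add_comm]
  rw [hcard, hsum]
  have hpow : χ a ^ ℓ = 1 := by
    rw [← MulChar.pow_apply' _ hℓ0.ne', ← hχ, pow_orderOf_eq_one,
      MulChar.one_apply (isUnit_iff_ne_zero.mpr ha)]
  split_ifs with h
  · obtain ⟨b, rfl⟩ := h
    have hb : b ≠ 0 := by rintro rfl; exact ha (zero_pow hℓ0.ne')
    have : χ (b ^ ℓ) = 1 := by
      rw [map_pow, ← MulChar.pow_apply' _ hℓ0.ne', ← hχ, pow_orderOf_eq_one,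
        MulChar.one_apply (isUnit_iff_ne_zero.mpr hb)]
    simp [this]
  · have h1 : χ a - 1 ≠ 0 :=
      sub_ne_zero.mpr fun h1 ↦ h (MulChar.exists_pow_eq_of_apply_eq_one hχ ha h1)
    have := geom_sum_mul (χ a) ℓ
    rw [hpow, sub_self] at this
    simpa using ((mul_eq_zero.mp this).resolve_right h1).symm

/-- The number of points on `y ^ ℓ = x ^ a * (1 - x) ^ b` as a sum of Jacobi sums. -/
lemma MulChar.card_pow_eq_mul_pow {R : Type*} [CommRing R] [IsDomain R] {ℓ : ℕ}
    [hℓ : Fact ℓ.Prime] {χ : MulChar F R} (hχ : orderOf χ = ℓ) {a b : ℕ} (ha : a ≠ 0)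
    (hb : b ≠ 0) :
    (Nat.card {pt : F × F // pt.2 ^ ℓ = pt.1 ^ a * (1 - pt.1) ^ b} : R) =
      Fintype.card F +
        ∑ i ∈ Finset.range (ℓ - 1), jacobiSum (χ ^ ((i + 1) * a)) (χ ^ ((i + 1) * b)) := by
  classical
  rw [Nat.card_congr (Equiv.subtypeProdEquivSigmaSubtype
    fun x y : F ↦ y ^ ℓ = x ^ a * (1 - x) ^ b), Nat.card_sigma, Nat.cast_sum]
  simp_rw [MulChar.card_pow_eq hχ, Finset.sum_add_distrib, jacobiSum]
  rw [Finset.sum_comm]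
  simp [pow_mul, MulChar.pow_apply' _ ha, MulChar.pow_apply' _ hb]

/-- If `p ^ k ≡ -1` modulo `n` and `χ ^ n = φ ^ n = 1`, then inverting both characters does not
change the Jacobi sum: it permutes the summands like the `p ^ k`-power Frobenius. -/
lemma jacobiSum_inv_inv_eq (p : ℕ) [Fact p.Prime] [CharP F p] {R : Type*} [CommRing R]
    {χ φ : MulChar F R} {n k : ℕ} (hχ : χ ^ n = 1) (hφ : φ ^ n = 1) (hk : n ∣ p ^ k + 1) :
    jacobiSum χ⁻¹ φ⁻¹ = jacobiSum χ φ := by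
  have hpk : p ^ k ≠ 0 := pow_ne_zero _ (Fact.out (p := p.Prime)).ne_zero
  have key {ψ : MulChar F R} (hψ : ψ ^ n = 1) (x : F) : ψ⁻¹ x = ψ (x ^ p ^ k) := by
    have : ψ⁻¹ = ψ ^ p ^ k := by
      obtain ⟨m, hm⟩ := hk
      rw [inv_eq_iff_mul_eq_one, ← pow_succ', hm, pow_mul, hψ, one_pow]
    rw [this, MulChar.pow_apply' _ hpk, map_pow]
  rw [jacobiSum, jacobiSum]
  refine Fintype.sum_equiv (iterateFrobeniusEquiv F p k).toEquiv _ _ fun x ↦ ?_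
  have h1 : (1 - x) ^ p ^ k = 1 - x ^ p ^ k := by
    rw [sub_pow_char_pow, one_pow]
  rw [key hχ, key hφ, h1]
  rfl

/-- A supersingular Jacobi sum of characters of prime order `ℓ` is an explicit rational integer,
normalized by its residue modulo `ℓ`. -/
lemma jacobiSum_eq_neg_intCast (p : ℕ) [Fact p.Prime] [CharP F p] {ℓ : ℕ} [hℓ : Fact ℓ.Prime]
    (hℓ2 : 2 < ℓ) {χ φ : MulChar F ℂ} {k : ℕ} (hχ : χ ^ ℓ = 1) (hφ : φ ^ ℓ = 1) (hχ1 : χ ≠ 1)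
    (hφ1 : φ ≠ 1) (hχφ : χ * φ ≠ 1) (hcard : ℓ ∣ Fintype.card F - 1) (hk : ℓ ∣ p ^ k + 1)
    {r : ℤ} (hr : r ^ 2 = Fintype.card F) (hrℓ : (ℓ : ℤ) ∣ r - 1) :
    jacobiSum χ φ = -r := by
  have hp : p.Prime := Fact.out
  have hsq : jacobiSum χ φ ^ 2 = (r : ℂ) ^ 2 := by
    have hchar : ringChar ℂ ≠ ringChar F := by
      rw [ringChar.eq_zero, ringChar.eq F p]
      exact hp.ne_zero.symm
    have := jacobiSum_mul_jacobiSum_inv hchar hχ1 hφ1 hχφ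
    rw [jacobiSum_inv_inv_eq p hχ hφ hk, ← sq] at this
    rw [this]
    exact_mod_cast hr.symm
  rcases sq_eq_sq_iff_eq_or_eq_neg.mp hsq with h | h
  · have hμ := Complex.isPrimitiveRoot_exp ℓ hℓ.out.ne_zero
    obtain ⟨z, hz, hJ⟩ := exists_jacobiSum_eq_neg_one_add hℓ2 hχ hφ hcard hμ
    set μ := Complex.exp (2 * Real.pi * Complex.I / ℓ)
    have hmem : z * (μ - 1) ∈ Algebra.adjoin ℤ {μ} :=
      mul_mem hz (sub_mem (Algebra.self_mem_adjoin_singleton ℤ μ) (one_mem _))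
    have hdvd : (ℓ : ℤ) ∣ r + 1 := by
      refine hμ.dvd_of_intCast_eq_mul_sub_one hmem ?_
      push_cast
      linear_combination hJ - h
    have h2 : (ℓ : ℤ) ∣ 2 := by
      have := dvd_sub hdvd hrℓ
      rwa [show r + 1 - (r - 1) = 2 by ring] at this
    have := Int.le_of_dvd two_pos h2
    omega
  · exact h

end FiniteField

lemma Nat.exists_five_dvd_pow_add_one {p : ℕ} (h0 : p % 5 ≠ 0) (h1 : p % 5 ≠ 1) :
    ∃ k, 5 ∣ p ^ k + 1 := by
  have : p % 5 = 2 ∨ p % 5 = 3 ∨ p % 5 = 4 := by omega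
  rcases this with h | h | h
  · exact ⟨2, by simp [Nat.dvd_iff_mod_eq_zero, Nat.add_mod, Nat.pow_mod, h]⟩
  · exact ⟨2, by simp [Nat.dvd_iff_mod_eq_zero, Nat.add_mod, Nat.pow_mod, h]⟩
  · exact ⟨1, by simp [Nat.dvd_iff_mod_eq_zero, Nat.add_mod, h]⟩

lemma Nat.even_of_pow_mod_five_eq_one {p n : ℕ} (h1 : p % 5 ≠ 1) (hn : p ^ n % 5 = 1) :
    Even n := by
  have h4 (m : ℕ) : 4 ^ m % 5 = 1 ∨ 4 ^ m % 5 = 4 := by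
    induction m with
    | zero => simp
    | succ m ih => rw [pow_succ]; omega
  by_contra hodd
  obtain ⟨m, rfl⟩ := Nat.not_even_iff_odd.mp hodd
  have hlt : p % 5 < 5 := Nat.mod_lt _ (by norm_num)
  have hsq : (p ^ 2) ^ m % 5 = ((p % 5) ^ 2 % 5) ^ m % 5 := by simp [Nat.pow_mod]
  rw [pow_succ, pow_mul, Nat.mul_mod, hsq] at hn
  generalize p % 5 = c at *
  interval_cases c <;> rcases h4 m with h | h <;> simp_all


/-- Let `F` be a finite field with `q` elements of characteristic `p ≠ 5`.
Suppose `p ≢ 1 (mod 5)` and `q ≡ 1 (mod 5)`. Then `q` is a perfect square, and if `q'`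
denotes the integer square root of `q` satisfying `q' ≡ 1 (mod 5)`, then the number of
pairs `(x, y) ∈ F × F` with `y^5 = x⁴(1-x)³` equals `q - 4q'`. -/
theorem stmt_5 {F : Type*} [Field F] [Fintype F] (p : ℕ) [Fact p.Prime] [CharP F p]
    (hp5 : p ≠ 5) (hp : p % 5 ≠ 1) (hq : Fintype.card F % 5 = 1) :
    ∃ q' : ℤ, q' ^ 2 = (Fintype.card F : ℤ) ∧ q' % 5 = 1 ∧
      (Nat.card {pt : F × F // pt.2 ^ 5 = pt.1 ^ 4 * (1 - pt.1) ^ 3} : ℤ) =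
        (Fintype.card F : ℤ) - 4 * q' := by
  
  classical
  have hp' : p.Prime := Fact.out
  have : Fact (Nat.Prime 5) := ⟨Nat.prime_five⟩
  have h0 : p % 5 ≠ 0 := fun h ↦
    hp5 ((Nat.prime_dvd_prime_iff_eq Nat.prime_five hp').mp (Nat.dvd_of_mod_eq_zero h)).symm
  obtain ⟨k, hk⟩ := Nat.exists_five_dvd_pow_add_one h0 hp
  obtain ⟨n, -, hn⟩ := FiniteField.card F p
  obtain ⟨m, hm⟩ := Nat.even_of_pow_mod_five_eq_one hp (hn ▸ hq)
  obtain ⟨r, hr, hr1⟩ : ∃ r : ℤ, r ^ 2 = Fintype.card F ∧ r % 5 = 1 := by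
    have hsq : ((p : ℤ) ^ m) ^ 2 = Fintype.card F := by
      rw [hn, hm]
      push_cast
      ring
    have hmod : ((p : ℤ) ^ m) ^ 2 % 5 = 1 := by omega
    generalize (p : ℤ) ^ m = s at *
    have : s % 5 = 0 ∨ s % 5 = 1 ∨ s % 5 = 2 ∨ s % 5 = 3 ∨ s % 5 = 4 := by omega
    rcases this with h | h | h | h | h
    · simp [sq, Int.mul_emod, h] at hmod
    · exact ⟨s, hsq, h⟩
    · simp [sq, Int.mul_emod, h] at hmod
    · simp [sq, Int.mul_emod, h] at hmod
    · exact ⟨-s, by rw [neg_sq, hsq], by omega⟩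
  refine ⟨r, hr, hr1, ?_⟩
  have hcard : 5 ∣ Fintype.card F - 1 := by omega
  obtain ⟨χ, hχ⟩ := MulChar.exists_mulChar_orderOf F hcard
    (Complex.isPrimitiveRoot_exp 5 (by norm_num))
  have hpow (j : ℕ) : (χ ^ j) ^ 5 = 1 := by
    rw [← pow_mul, mul_comm, pow_mul, ← hχ, pow_orderOf_eq_one, one_pow]
  have hne {j : ℕ} (hj : ¬ 5 ∣ j) : χ ^ j ≠ 1 := fun h ↦ hj (hχ ▸ orderOf_dvd_of_pow_eq_one h)
  have hJ : ∀ i ∈ Finset.range (5 - 1),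
      jacobiSum (χ ^ ((i + 1) * 4)) (χ ^ ((i + 1) * 3)) = -r := fun i hi ↦ by
    rw [Finset.mem_range] at hi
    exact jacobiSum_eq_neg_intCast p (by norm_num) (hpow _) (hpow _) (hne (by omega))
      (hne (by omega)) (by rw [← pow_add]; exact hne (by omega)) hcard hk hr (by omega)
  have hN := MulChar.card_pow_eq_mul_pow hχ (a := 4) (b := 3) (by norm_num) (by norm_num)
  rw [Finset.sum_congr rfl hJ, Finset.sum_const, Finset.card_range] at hN
  have : (Nat.card {pt : F × F // pt.2 ^ 5 = pt.1 ^ 4 * (1 - pt.1) ^ 3} : ℂ) =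
      Fintype.card F - 4 * r := by
    rw [hN, nsmul_eq_mul]
    push_cast
    ring
  exact_mod_cast this
end

section
/- Let q ≡ 1 (mod 5), let χ be a nontrivial multiplicative character of F_q^* with χ^5 = 1, let η be any multiplicative character of F_q^*, and let a, b be integers with 1 ≤ a, b ≤ 4. For λ ∈ F_q^* set N(C_λ,χ) = Σ_{x ∈ F_q, x ≠ 0, x ≠ 1, x ≠ 1/λ} χ^a(x)·χ^b(1−x)·χ^{−b}(1−λx). Then Σ_{λ ∈ F_q^*} N(C_λ,χ)·η^{−1}(λ) = J(χ^a η, χ^b) · J(χ^{−b}, η^{−1}). -/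
/-- The Jacobi sum `J(χ, χ') = ∑_{x ∈ F, x ≠ 0, x ≠ 1} χ(x) χ'(1-x)`. -/
noncomputable def jacobiSum' {F : Type*} [Field F] [Fintype F]
    (χ χ' : MulChar F ℂ) : ℂ :=
  letI := Classical.decEq F
  ∑ x ∈ Finset.univ.filter (fun x : F => x ≠ 0 ∧ x ≠ 1), χ x * χ' (1 - x)

open Finset in
/-- `N(C_λ, χ) = ∑_{x ∈ F, x ≠ 0, x ≠ 1, x ≠ 1/λ} χ^a(x) χ^b(1-x) χ^{-b}(1-λx)`. -/
noncomputable def Ncurve {F : Type*} [Field F] [Fintype F] (a b : ℕ)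
    (lam : F) (χ : MulChar F ℂ) : ℂ :=
  letI := Classical.decEq F
  ∑ x ∈ Finset.univ.filter (fun x : F => x ≠ 0 ∧ x ≠ 1 ∧ x ≠ lam⁻¹),
    (χ ^ a) x * (χ ^ b) (1 - x) * (χ ^ (-(b : ℤ))) (1 - lam * x)

/-- Dropping the points `0` and `1` does not change a Jacobi sum over a finite field. -/
lemma jacobiSum'_eq_jacobiSum {F : Type*} [Field F] [Fintype F] (χ ψ : MulChar F ℂ) :
    jacobiSum' χ ψ = jacobiSum χ ψ := by
  classical
  unfold jacobiSum' jacobiSum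
  refine Finset.sum_subset_zero_on_sdiff (Finset.subset_univ _) ?_ fun _ _ => rfl
  intro x hx
  by_cases h0 : x = 0
  · rw [h0, MulChar.map_zero, zero_mul]
  · have h1 : x = 1 := by simpa [h0] using hx
    rw [h1, sub_self, MulChar.map_zero, mul_zero]

/-- For `lam ≠ 0`, the sum defining `Ncurve` may be taken over the whole field. -/
lemma Ncurve_eq_sum_univ {F : Type*} [Field F] [Fintype F] (a b : ℕ) {lam : F}
    (hlam : lam ≠ 0) (χ : MulChar F ℂ) :
    Ncurve a b lam χ =
      ∑ x : F, (χ ^ a) x * (χ ^ b) (1 - x) * (χ ^ (-(b : ℤ))) (1 - lam * x) := by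
  classical
  unfold Ncurve
  refine Finset.sum_subset_zero_on_sdiff (Finset.subset_univ _) ?_ fun _ _ => rfl
  intro x hx
  by_cases h0 : x = 0
  · rw [h0, MulChar.map_zero, zero_mul, zero_mul]
  by_cases h1 : x = 1
  · rw [h1, sub_self, MulChar.map_zero, mul_zero, zero_mul]
  · have h2 : x = lam⁻¹ := by simpa [h0, h1] using hx
    rw [h2, mul_inv_cancel₀ hlam, sub_self, MulChar.map_zero, mul_zero]

/-- Rescaling the variable of a Jacobi sum by a nonzero `x`. -/
lemma sum_mulChar_one_sub_mul {F : Type*} [Field F] [Fintype F] (ψ η : MulChar F ℂ)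
    {x : F} (hx : x ≠ 0) :
    ∑ lam : F, ψ (1 - lam * x) * η⁻¹ lam = η x * jacobiSum ψ η⁻¹ := by
  rw [jacobiSum_comm, jacobiSum, Finset.mul_sum]
  refine Fintype.sum_equiv (Equiv.mulRight₀ x hx) _ _ fun lam => ?_
  have h : η x * η⁻¹ x = 1 := by
    rw [← MulChar.mul_apply, mul_inv_cancel, MulChar.one_apply hx.isUnit]
  rw [Equiv.mulRight₀_apply, map_mul]
  linear_combination (-(ψ (1 - lam * x) * η⁻¹ lam)) * h

open scoped Classical in
/-- Let `F` be a finite field with `q ≡ 1 (mod 5)` elements of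
characteristic `p ≠ 5`, let `χ` be a nontrivial multiplicative character with `χ⁵ = 1`,
let `η` be any multiplicative character, and let `1 ≤ a, b ≤ 4`. Then
`∑_{λ ∈ F*} N(C_λ, χ) η⁻¹(λ) = J(χ^a η, χ^b) J(χ^{-b}, η⁻¹)`. -/
theorem stmt_7 {F : Type*} [Field F] [Fintype F] (hchar : ringChar F ≠ 5)
    (hq : Fintype.card F % 5 = 1) (χ : MulChar F ℂ) (hχ : χ ≠ 1) (hχ5 : χ ^ 5 = 1)
    (η : MulChar F ℂ) (a b : ℕ) (ha1 : 1 ≤ a) (ha4 : a ≤ 4) (hb1 : 1 ≤ b) (hb4 : b ≤ 4) :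
    ∑ lam ∈ Finset.univ.filter (fun lam : F => lam ≠ 0),
        Ncurve a b lam χ * η⁻¹ lam =
      jacobiSum' (χ ^ a * η) (χ ^ b) * jacobiSum' (χ ^ (-(b : ℤ))) η⁻¹ := by
  rw [jacobiSum'_eq_jacobiSum, jacobiSum'_eq_jacobiSum]
  calc
    _ = ∑ lam : F, ∑ x : F, (χ ^ a) x * (χ ^ b) (1 - x) *
          (χ ^ (-(b : ℤ))) (1 - lam * x) * η⁻¹ lam := by
      rw [Finset.sum_filter]
      refine Finset.sum_congr rfl fun lam _ => ?_
      by_cases h : lam = 0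
      · rw [if_neg (not_not.mpr h), h]
        simp only [MulChar.map_zero, mul_zero, Finset.sum_const_zero]
      · rw [if_pos h, Ncurve_eq_sum_univ a b h, Finset.sum_mul]
    _ = _ := by
      rw [Finset.sum_comm, jacobiSum, Finset.sum_mul]
      refine Finset.sum_congr rfl fun x _ => ?_
      by_cases h : x = 0
      · simp only [h, MulChar.map_zero, zero_mul, Finset.sum_const_zero]
      · simp only [mul_assoc ((χ ^ a) x * (χ ^ b) (1 - x))]
        rw [← Finset.mul_sum, sum_mulChar_one_sub_mul _ _ h, MulChar.mul_apply]
        ring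
end
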